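/- Let A = {(x,y,z) ∈ ℝ³ : z² = 2(x² + y²), z > 0} ∪ {(x,y,z) ∈ ℝ³ : y² = 2(x² + z²), y > 0}. Then LGD(A) = ℝ³; in particular GD is stabilised at degree 1 for A. -/

import Mathlib

open Filter Topology Metric Set

/-- The direction set `D_p(A)` of `A ⊆ ℝⁿ` at `p`: unit vectors `a` for which there is a
sequence in `A \ {p}` converging to `p` whose normalised secants converge to `a`. -/
def dirSet {n : ℕ} (A : Set (EuclideanSpace ℝ (Fin n))) (p : EuclideanSpace ℝ (Fin n)) :
    Set (EuclideanSpace ℝ (Fin n)) :=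
  {a | ‖a‖ = 1 ∧ ∃ x : ℕ → EuclideanSpace ℝ (Fin n),
    (∀ i, x i ∈ A ∧ x i ≠ p) ∧
    Tendsto x atTop (nhds p) ∧
    Tendsto (fun i => (‖x i - p‖)⁻¹ • (x i - p)) atTop (nhds a)}

/-- `D_A(A) = {(p, a) : p ∈ A, a ∈ D_p(A)} ⊆ ℝⁿ × ℝⁿ`. -/
def dirBundle {n : ℕ} (A : Set (EuclideanSpace ℝ (Fin n))) :
    Set (EuclideanSpace ℝ (Fin n) × EuclideanSpace ℝ (Fin n)) :=
  {pa | pa.1 ∈ A ∧ pa.2 ∈ dirSet A pa.1}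

/-- The geometric directional bundle of `A` at `0`:
`GD(A) = {a ∈ S^{n-1} : (0, a) ∈ cl(D_A(A))}`. -/
def GD {n : ℕ} (A : Set (EuclideanSpace ℝ (Fin n))) : Set (EuclideanSpace ℝ (Fin n)) :=
  {a | ((0 : EuclideanSpace ℝ (Fin n)), a) ∈ closure (dirBundle A)}

/-- The half-cone `LGD(A) = {t a : t ≥ 0, a ∈ GD(A)}`. -/
def LGD {n : ℕ} (A : Set (EuclideanSpace ℝ (Fin n))) : Set (EuclideanSpace ℝ (Fin n)) :=
  {x | ∃ t : ℝ, 0 ≤ t ∧ ∃ a ∈ GD A, x = t • a}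


/-- A velocity vector of a curve in `A` is a direction of `A` at the starting point. -/
theorem mem_dirSet_of_hasDerivAt {n : ℕ} {A : Set (EuclideanSpace ℝ (Fin n))}
    {γ : ℝ → EuclideanSpace ℝ (Fin n)} {a : EuclideanSpace ℝ (Fin n)}
    (hγ : HasDerivAt γ a 0) (ha : ‖a‖ = 1) (hA : ∀ᶠ u in 𝓝[>] 0, γ u ∈ A) :
    a ∈ dirSet A (γ 0) := by
  have ha0 : a ≠ 0 := by
    rintro rfl
    simp at ha
  have hle : 𝓝[>] (0 : ℝ) ≤ 𝓝[≠] 0 := nhdsWithin_mono _ fun _ hx => ne_of_gt hx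
  have hne : ∀ᶠ u in 𝓝[>] (0 : ℝ), γ u ≠ γ 0 := (hγ.eventually_ne ha0).filter_mono hle
  obtain ⟨w, hw⟩ := exists_seq_tendsto (𝓝[>] (0 : ℝ))
  obtain ⟨N, hN⟩ := eventually_atTop.1
    (hw.eventually ((hA.and hne).and self_mem_nhdsWithin))
  have hv : Tendsto (fun i => w (i + N)) atTop (𝓝[>] (0 : ℝ)) :=
    hw.comp (tendsto_add_atTop_nat N)
  have hslope : Tendsto (fun i => (w (i + N))⁻¹ • (γ (w (i + N)) - γ 0)) atTop (𝓝 a) := by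
    have h := (hasDerivAt_iff_tendsto_slope.1 hγ).comp (hv.mono_right hle)
    simpa [Function.comp_def, slope_def_module] using h
  refine ⟨ha, fun i => γ (w (i + N)), fun i => (hN _ (Nat.le_add_left N i)).1,
    hγ.continuousAt.tendsto.comp (hv.mono_right nhdsWithin_le_nhds), ?_⟩
  have h := (hslope.norm.inv₀ (by simp [ha])).smul hslope
  rw [ha, inv_one, one_smul] at h
  refine h.congr fun i => ?_
  have hpos : 0 < w (i + N) := (hN _ (Nat.le_add_left N i)).2
  rw [norm_smul, Real.norm_of_nonneg (inv_pos.2 hpos).le, smul_smul, mul_inv, inv_inv,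
    mul_right_comm, mul_inv_cancel₀ hpos.ne', one_mul]

/-- On the cone `z² = 2 (x² + y²)`, `z > 0` (coordinates permuted by `σ`), every unit vector
tangent to the cone at a point is a direction there. -/
theorem mem_dirBundle_of_cone (σ : Equiv.Perm (Fin 3)) {A : Set (EuclideanSpace ℝ (Fin 3))}
    (hA : ∀ v : EuclideanSpace ℝ (Fin 3),
      v (σ 2) ^ 2 = 2 * (v (σ 0) ^ 2 + v (σ 1) ^ 2) → 0 < v (σ 2) → v ∈ A)
    {a : EuclideanSpace ℝ (Fin 3)} (ha : ‖a‖ = 1) {x y : ℝ} (hxy : 0 < x ^ 2 + y ^ 2)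
    (htan : 2 * (x * a (σ 0) + y * a (σ 1)) = √(2 * (x ^ 2 + y ^ 2)) * a (σ 2)) :
    (WithLp.toLp 2 fun i => ![x, y, √(2 * (x ^ 2 + y ^ 2))] (σ.symm i), a) ∈ dirBundle A := by
  let X : ℝ → ℝ := fun u => x + u * a (σ 0)
  let Y : ℝ → ℝ := fun u => y + u * a (σ 1)
  let q : ℝ → ℝ := fun u => 2 * (X u ^ 2 + Y u ^ 2)
  let γ : ℝ → EuclideanSpace ℝ (Fin 3) := fun u =>
    WithLp.toLp 2 fun i => ![X u, Y u, √(q u)] (σ.symm i)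
  have hX : HasDerivAt X (a (σ 0)) 0 :=
    (((hasDerivAt_id (0 : ℝ)).mul_const (a (σ 0))).const_add x).congr_deriv (one_mul _)
  have hY : HasDerivAt Y (a (σ 1)) 0 :=
    (((hasDerivAt_id (0 : ℝ)).mul_const (a (σ 1))).const_add y).congr_deriv (one_mul _)
  have hX0 : X 0 = x := by simp [X]
  have hY0 : Y 0 = y := by simp [Y]
  have hq0 : q 0 = 2 * (x ^ 2 + y ^ 2) := by simp [q, hX0, hY0]
  have hq0pos : 0 < q 0 := by rw [hq0]; positivity
  have hq : HasDerivAt q (2 * (2 * (x * a (σ 0) + y * a (σ 1)))) 0 := by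
    refine (((hX.pow 2).add (hY.pow 2)).const_mul 2).congr_deriv ?_
    rw [hX0, hY0]
    push_cast
    ring
  have hsqrt : HasDerivAt (fun u => √(q u)) (a (σ 2)) 0 := by
    convert hq.sqrt hq0pos.ne' using 1
    rw [htan, hq0, ← mul_assoc, mul_div_cancel_left₀]
    positivity
  have hγ : HasDerivAt γ a 0 := by
    have h : HasDerivAt (fun u i => γ u i) (fun i => a i) 0 := by
      refine hasDerivAt_pi.2 fun i => ?_
      obtain ⟨j, rfl⟩ := σ.surjective i
      fin_cases j
      · simpa [γ] using hX
      · simpa [γ] using hY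
      · simpa [γ] using hsqrt
    exact (PiLp.continuousLinearEquiv 2 ℝ fun _ : Fin 3 => ℝ).symm.hasFDerivAt.comp_hasDerivAt 0 h
  have hmem : ∀ u, 0 < q u → γ u ∈ A := fun u hu =>
    hA _ (by simpa [γ] using Real.sq_sqrt hu.le) (by simpa [γ] using hu)
  have hγ0 : γ 0 = WithLp.toLp 2 fun i => ![x, y, √(2 * (x ^ 2 + y ^ 2))] (σ.symm i) := by
    simp only [γ, hX0, hY0, hq0]
  rw [← hγ0]
  exact ⟨hmem 0 hq0pos, mem_dirSet_of_hasDerivAt hγ ha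
    (((hq.continuousAt.eventually_const_lt hq0pos).filter_mono nhdsWithin_le_nhds).mono hmem)⟩

/-- A vector outside the open cone `a₂² > 2 (a₀² + a₁²)` is tangent to the cone
`z² = 2 (x² + y²)` along some ruling. -/
theorem exists_ruling_tangent {a b c : ℝ} (h : c ^ 2 ≤ 2 * (a ^ 2 + b ^ 2)) :
    ∃ x y : ℝ, x ^ 2 + y ^ 2 = 1 ∧ 2 * (x * a + y * b) = √2 * c := by
  have h2 : √2 ^ 2 = 2 := Real.sq_sqrt (by norm_num)
  rcases eq_or_lt_of_le (by positivity : 0 ≤ a ^ 2 + b ^ 2) with hr | hr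
  · have ha : a = 0 := by nlinarith [sq_nonneg a, sq_nonneg b]
    have hb : b = 0 := by nlinarith [sq_nonneg a, sq_nonneg b]
    have hc : c = 0 := by nlinarith [sq_nonneg c]
    exact ⟨1, 0, by norm_num, by simp [ha, hb, hc]⟩
  · have hm : √(a ^ 2 + b ^ 2 - c ^ 2 / 2) ^ 2 = a ^ 2 + b ^ 2 - c ^ 2 / 2 :=
      Real.sq_sqrt (by linarith)
    set m := √(a ^ 2 + b ^ 2 - c ^ 2 / 2)
    refine ⟨(√2 * c / 2 * a - m * b) / (a ^ 2 + b ^ 2),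
      (√2 * c / 2 * b + m * a) / (a ^ 2 + b ^ 2), ?_, ?_⟩
    · have h1 : (√2 * c / 2 * a - m * b) ^ 2 + (√2 * c / 2 * b + m * a) ^ 2 =
          (a ^ 2 + b ^ 2) ^ 2 := by
        linear_combination (a ^ 2 + b ^ 2) * hm + (a ^ 2 + b ^ 2) * c ^ 2 / 4 * h2
      rw [div_pow, div_pow, ← add_div, h1, div_self (by positivity)]
    · field_simp
      ring

/-- If `A` contains the cone `z² = 2 (x² + y²)`, `z > 0` (coordinates permuted by `σ`), then
`GD A` contains all unit vectors outside the open cone `z² > 2 (x² + y²)`. -/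
theorem mem_GD_of_cone (σ : Equiv.Perm (Fin 3)) {A : Set (EuclideanSpace ℝ (Fin 3))}
    (hA : ∀ v : EuclideanSpace ℝ (Fin 3),
      v (σ 2) ^ 2 = 2 * (v (σ 0) ^ 2 + v (σ 1) ^ 2) → 0 < v (σ 2) → v ∈ A)
    {a : EuclideanSpace ℝ (Fin 3)} (ha : ‖a‖ = 1)
    (h : a (σ 2) ^ 2 ≤ 2 * (a (σ 0) ^ 2 + a (σ 1) ^ 2)) : a ∈ GD A := by
  obtain ⟨x, y, hxy, htan⟩ := exists_ruling_tangent h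
  let p : EuclideanSpace ℝ (Fin 3) := WithLp.toLp 2 fun i => ![x, y, √2] (σ.symm i)
  have hlim : Tendsto (fun t : ℝ => (t • p, a)) (𝓝[>] 0) (𝓝 (0, a)) := by
    have hc : Continuous fun t : ℝ => (t • p, a) := by fun_prop
    simpa using (hc.tendsto 0).mono_left nhdsWithin_le_nhds
  refine mem_closure_of_tendsto hlim (eventually_nhdsWithin_of_forall fun t (ht : 0 < t) => ?_)
  have hnorm : (t * x) ^ 2 + (t * y) ^ 2 = t ^ 2 := by linear_combination t ^ 2 * hxy
  have hsqrt : √(2 * ((t * x) ^ 2 + (t * y) ^ 2)) = t * √2 := by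
    rw [hnorm, mul_comm, Real.sqrt_mul (sq_nonneg t), Real.sqrt_sq ht.le]
  have hmem := mem_dirBundle_of_cone σ hA ha (x := t * x) (y := t * y)
    (by rw [hnorm]; positivity) (by rw [hsqrt]; linear_combination t * htan)
  convert hmem using 2
  ext i
  obtain ⟨j, rfl⟩ := σ.surjective i
  rw [hsqrt]
  fin_cases j <;> simp [p]

/-- For A = {z² = 2(x² + y²), z > 0} ∪ {y² = 2(x² + z²), y > 0} ⊆ ℝ³,
LGD(A) = ℝ³; in particular GD is stabilised at degree 1 for A. -/
theorem stmt_8 (A : Set (EuclideanSpace ℝ (Fin 3)))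
    (hA : A = {v | (v 2) ^ 2 = 2 * ((v 0) ^ 2 + (v 1) ^ 2) ∧ 0 < v 2} ∪
              {v | (v 1) ^ 2 = 2 * ((v 0) ^ 2 + (v 2) ^ 2) ∧ 0 < v 1}) :
    LGD A = Set.univ := by
  have hGD : ∀ a : EuclideanSpace ℝ (Fin 3), ‖a‖ = 1 → a ∈ GD A := by
    intro a ha
    rcases le_total (a 2 ^ 2) (a 1 ^ 2) with h | h
    · refine mem_GD_of_cone (Equiv.refl _) (fun v hv hv' => ?_) ha ?_
      · rw [hA]
        exact Or.inl ⟨hv, hv'⟩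
      · change a 2 ^ 2 ≤ 2 * (a 0 ^ 2 + a 1 ^ 2)
        nlinarith [sq_nonneg (a 0), sq_nonneg (a 1)]
    · have h0 : Equiv.swap (1 : Fin 3) 2 0 = 0 := by decide
      refine mem_GD_of_cone (Equiv.swap 1 2) (fun v hv hv' => ?_) ha ?_
      · rw [hA]
        simp only [Equiv.swap_apply_left, Equiv.swap_apply_right, h0] at hv hv'
        exact Or.inr ⟨hv, hv'⟩
      · simp only [Equiv.swap_apply_left, Equiv.swap_apply_right, h0]
        nlinarith [sq_nonneg (a 0), sq_nonneg (a 2)]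
  refine eq_univ_of_forall fun v => ?_
  rcases eq_or_ne v 0 with rfl | hv
  · exact ⟨0, le_rfl, EuclideanSpace.single 0 1, hGD _ (by simp), by simp⟩
  · exact ⟨‖v‖, norm_nonneg v, ‖v‖⁻¹ • v, hGD _ (norm_smul_inv_norm (𝕜 := ℝ) hv),
      (smul_inv_smul₀ (norm_ne_zero_iff.2 hv) v).symm⟩
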